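/- Let G be a simple graph on a finite vertex type, let α be a real number with 0 ≤ α ≤ 1, let A_α(G) = α·D(G) + (1 − α)·A(G), and let v be a vertex of G. Then the permanental polynomial satisfies ψ(A_α(G)) = (x − α·d(v))·ψ((A_α)_v(G)) + (1 − α)²·Σ_{u ∈ N(v)} ψ((A_α)_{uv}(G)) + 2·Σ_{C ∈ 𝔠_G(v)} (1 − α)^{|V(C)|}·(−1)^{|V(C)|}·ψ((A_α)_{V(C)}(G)). -/

import Mathlib

open Polynomial Matrix

attribute [local instance] Classical.propDecidable

noncomputable section

/-- The permanent of a square matrix: `per M = ∑_{σ} ∏_i M i (σ i)`. -/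
def Matrix.per {n R : Type*} [Fintype n] [DecidableEq n] [CommRing R]
    (M : Matrix n n R) : R :=
  ∑ σ : Equiv.Perm n, ∏ i, M i (σ i)

/-- The characteristic polynomial `φ(M) = det (x·I - M)`. -/
def phi {n R : Type*} [Fintype n] [DecidableEq n] [CommRing R]
    (M : Matrix n n (Polynomial R)) : Polynomial R :=
  ((Polynomial.X : Polynomial R) • (1 : Matrix n n (Polynomial R)) - M).det

/-- The permanental polynomial `ψ(M) = per (x·I - M)`. -/
def psi {n R : Type*} [Fintype n] [DecidableEq n] [CommRing R]
    (M : Matrix n n (Polynomial R)) : Polynomial R :=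
  ((Polynomial.X : Polynomial R) • (1 : Matrix n n (Polynomial R)) - M).per

variable {V : Type*}

/-- The principal submatrix of `M` obtained by deleting the rows and columns indexed by `S`. -/
def delSub {R : Type*} (M : Matrix V V R) (S : Set V) :
    Matrix {w : V // w ∉ S} {w : V // w ∉ S} R :=
  M.submatrix Subtype.val Subtype.val

/-- `C` is a cycle of `G`: a subgraph of `G` that is connected, has nonempty vertex set,
and in which every vertex of `C` has degree exactly `2` in `C`. -/
def IsCycleSub (G : SimpleGraph V) (C : G.Subgraph) : Prop :=
  C.Connected ∧ C.verts.Nonempty ∧ ∀ w ∈ C.verts, (C.neighborSet w).ncard = 2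

variable [Fintype V] [DecidableEq V]

/-- The degree diagonal matrix `D(G)` of a graph. -/
def degMat (R : Type*) [CommRing R] (G : SimpleGraph V) [DecidableRel G.Adj] :
    Matrix V V R :=
  Matrix.diagonal fun w => (G.degree w : R)

/-- The matrix `A_α(G) = α·D(G) + (1-α)·A(G)` over `ℝ[x]`. -/
def aAlpha (α : ℝ) (G : SimpleGraph V) [DecidableRel G.Adj] :
    Matrix V V (Polynomial ℝ) :=
  Polynomial.C α • degMat (Polynomial ℝ) G + Polynomial.C (1 - α) • G.adjMatrix (Polynomial ℝ)

section PermAux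

open Equiv Equiv.Perm

/-- Permanent of the principal submatrix, with fixed instances. -/
def dper {R : Type*} [CommRing R] (M : Matrix V V R) (S : Set V) : R :=
  (delSub M S).per

/-- Contribution of the permutations with prescribed cycle through `v`. -/
theorem per_fiber {R : Type*} [CommRing R] (M : Matrix V V R) (v : V) (S : Set V) (T : Finset V)
    (c : Equiv.Perm V) (hT : ∀ i, i ∈ T ↔ i ∈ S) (hv : v ∈ S) (hc : ∀ i, i ∉ S → c i = i) (hcv : c.cycleOf v = c)
    (hσ : ∀ σ : Equiv.Perm V, σ.cycleOf v = c → ∀ i ∈ S, σ i = c i) :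
    ∑ σ : Equiv.Perm V with σ.cycleOf v = c, ∏ i, M i (σ i) =
      (∏ i ∈ T, M i (c i)) * dper M S := by
  have hdisj : ∀ τ : Equiv.Perm {w : V // w ∉ S}, c.Disjoint (ofSubtype τ) := by
    intro τ i
    by_cases hi : i ∈ S
    · right
      exact ofSubtype_apply_of_not_mem τ (by simpa using hi)
    · left
      exact hc i hi
  have hTS : T = Finset.univ.filter (fun i => i ∈ S) := by
    ext i
    simp [hT]
  rw [hTS]
  unfold dper Matrix.per
  rw [Finset.mul_sum]
  symm
  refine Finset.sum_bij (fun τ _ => c * ofSubtype τ) ?_ ?_ ?_ ?_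
  · intro τ _
    simp only [Finset.mem_filter, Finset.mem_univ, true_and]
    rw [(hdisj τ).cycleOf_mul_distrib, hcv]
    have : (ofSubtype τ).cycleOf v = 1 := by
      rw [cycleOf_eq_one_iff]
      exact ofSubtype_apply_of_not_mem τ (by simpa using hv)
    rw [this, mul_one]
  · intro τ _ τ' _ h
    exact ofSubtype_injective (mul_left_cancel h)
  · intro σ hs
    simp only [Finset.mem_filter, Finset.mem_univ, true_and] at hs
    have h1 : ∀ i ∈ S, (c⁻¹ * σ) i = i := by
      intro i hi
      rw [Equiv.Perm.mul_apply, hσ σ hs i hi]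
      simp
    have h2 : ∀ x, (c⁻¹ * σ) x ∉ S ↔ x ∉ S := by
      intro x
      rw [not_iff_not]
      constructor
      · intro h
        have := h1 _ h
        have := (c⁻¹ * σ).injective this
        rwa [this] at h
      · intro h
        rwa [h1 x h]
    refine ⟨(c⁻¹ * σ).subtypePerm h2, Finset.mem_univ _, ?_⟩
    rw [ofSubtype_subtypePerm h2 ?_]
    · simp
    · intro x hx hS
      exact hx (h1 x hS)
  · intro τ _
    rw [← Finset.prod_filter_mul_prod_filter_not Finset.univ (fun i => i ∈ S)]
    congr 1
    · refine Finset.prod_congr rfl ?_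
      intro i hi
      simp only [Finset.mem_filter, Finset.mem_univ, true_and] at hi
      rw [Equiv.Perm.mul_apply, ofSubtype_apply_of_not_mem τ (by simpa using hi)]
    · rw [← Finset.prod_subtype_eq_prod_filter]
      refine Finset.prod_bij (fun i _ => ⟨i.1, i.2⟩) (by simp) (by simp) (by simp) ?_
      intro i _
      rw [Equiv.Perm.mul_apply, ofSubtype_apply_of_mem τ i.2, hc _ (τ ⟨i.1, i.2⟩).2]
      rfl

/-- The subgraph of `G` spanned by the edges `x - c x`. -/
def cyc (G : SimpleGraph V) (c : Equiv.Perm V) : G.Subgraph where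
  verts := {x | c x ≠ x}
  Adj a b := G.Adj a b ∧ (c a = b ∨ c b = a)
  adj_sub h := h.1
  edge_vert := by
    rintro a b ⟨h, h' | h'⟩
    · exact fun h2 => h.ne (h2.symm.trans h')
    · intro h2
      exact h.ne (c.injective (h2.trans h'.symm))
  symm := ⟨fun a b h => ⟨h.1.symm, h.2.symm⟩⟩

/-- Permutations that are cycles of `G` through `v`. -/
def Good (G : SimpleGraph V) (v : V) (c : Equiv.Perm V) : Prop :=
  c.IsCycle ∧ c v ≠ v ∧ (∀ x, c x ≠ x → G.Adj x (c x)) ∧ 3 ≤ c.support.card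

theorem Good.sq_ne {G : SimpleGraph V} {v : V} {c : Equiv.Perm V} (h : Good G v c) (x : V)
    (hx : c x ≠ x) : c (c x) ≠ x := by
  intro h2
  have h3 : c ^ 2 = 1 := by
    rw [h.1.pow_eq_one_iff]
    exact ⟨x, hx, by simpa [pow_two] using h2⟩
  have h4 := orderOf_le_of_pow_eq_one (by norm_num) h3
  rw [h.1.orderOf] at h4
  have := h.2.2.2
  omega

theorem Good.inv {G : SimpleGraph V} {v : V} {c : Equiv.Perm V} (h : Good G v c) :
    Good G v c⁻¹ := by
  refine ⟨h.1.inv, ?_, ?_, by simpa using h.2.2.2⟩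
  · intro h2
    apply h.2.1
    conv_lhs => rw [← h2]
    simp
  · intro x hx
    have := h.2.2.1 (c⁻¹ x) (by simpa using fun h => hx h.symm)
    simpa using this.symm

theorem Good.neighborSet {G : SimpleGraph V} {v : V} {c : Equiv.Perm V} (h : Good G v c) (x : V)
    (hx : c x ≠ x) : (cyc G c).neighborSet x = {c x, c⁻¹ x} := by
  ext y
  simp only [SimpleGraph.Subgraph.mem_neighborSet, Set.mem_insert_iff, Set.mem_singleton_iff, cyc]
  constructor
  · rintro ⟨_, h | h⟩
    · exact Or.inl h.symm
    · right; rw [← h]; simp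
  · rintro (h' | h')
    · subst h'
      exact ⟨h.2.2.1 x hx, Or.inl rfl⟩
    · subst h'
      refine ⟨h.inv.2.2.1 x ?_, by simp⟩
      intro h2
      apply hx
      conv_lhs => rw [← h2]
      simp

theorem Good.isCycleSub {G : SimpleGraph V} {v : V} {c : Equiv.Perm V} (h : Good G v c) :
    IsCycleSub G (cyc G c) ∧ v ∈ (cyc G c).verts := by
  refine ⟨⟨?_, ⟨v, h.2.1⟩, ?_⟩, h.2.1⟩
  · have hmem : ∀ n : ℕ, (c ^ n) v ∈ (cyc G c).verts := by
      intro n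
      change c ((c ^ n) v) ≠ (c ^ n) v
      rw [← Equiv.Perm.mul_apply, ← pow_succ', pow_succ, Equiv.Perm.mul_apply]
      exact fun h2 => h.2.1 ((c ^ n).injective h2)
    have hreach : ∀ n : ℕ, (cyc G c).coe.Reachable ⟨v, h.2.1⟩ ⟨(c ^ n) v, hmem n⟩ := by
      intro n
      induction n with
      | zero => exact SimpleGraph.Reachable.refl _
      | succ n ih =>
        refine ih.trans (SimpleGraph.Adj.reachable ?_)
        have h3 := hmem n
        refine ⟨?_, Or.inl ?_⟩
        · have := h.2.2.1 _ h3
          simpa [pow_succ'] using this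
        · simp [pow_succ']
    rw [SimpleGraph.Subgraph.connected_iff']
    rw [SimpleGraph.connected_iff_exists_forall_reachable]
    refine ⟨⟨v, h.2.1⟩, ?_⟩
    rintro ⟨w, hw⟩
    obtain ⟨n, hn⟩ := h.1.exists_pow_eq h.2.1 hw
    subst hn
    exact hreach n
  · intro w hw
    rw [h.neighborSet w hw]
    refine Set.ncard_pair ?_
    intro h2
    apply h.sq_ne w hw
    rw [h2]
    simp

theorem Good.eq_of_cyc_eq {G : SimpleGraph V} {v : V} {c c' : Equiv.Perm V} (h : Good G v c)
    (h' : Good G v c') (hcyc : cyc G c' = cyc G c) (hv : c' v = c v) : c' = c := by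
  have hs : ∀ x, c' x ≠ x ↔ c x ≠ x := fun x => by
    have : x ∈ (cyc G c').verts ↔ x ∈ (cyc G c).verts := by rw [hcyc]
    exact this
  have key : ∀ n : ℕ, c' ((c ^ n) v) = c ((c ^ n) v) := by
    intro n
    induction n with
    | zero => simpa using hv
    | succ n ih =>
      set y := (c ^ n) v with hy
      have e : (c ^ (n + 1)) v = c y := by rw [pow_succ', Equiv.Perm.mul_apply]
      rw [e]
      have hyc : c y ≠ y := by
        rw [hy, ← Equiv.Perm.mul_apply, ← pow_succ', pow_succ, Equiv.Perm.mul_apply]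
        exact fun h2 => h.2.1 ((c ^ n).injective h2)
      have hyc2 : c (c y) ≠ c y := fun h2 => hyc (c.injective h2)
      have h1 : c' (c y) ∈ (cyc G c').neighborSet (c y) := by
        rw [h'.neighborSet _ ((hs _).2 hyc2)]
        simp
      rw [hcyc, h.neighborSet _ hyc2] at h1
      rcases h1 with h1 | h1
      · exact h1
      · exfalso
        have h2 : c' (c y) = y := by simpa using h1
        rw [← ih] at h2
        exact h'.sq_ne y ((hs y).2 hyc) h2
  ext x
  by_cases hx : c x = x
  · have := not_iff_not.2 (hs x)
    simp only [not_not] at this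
    rw [hx, this.2 hx]
  · obtain ⟨n, hn⟩ := h.1.exists_pow_eq h.2.1 hx
    subst hn
    exact key n

theorem cyc_inv (G : SimpleGraph V) (c : Equiv.Perm V) : cyc G c⁻¹ = cyc G c := by
  ext a b
  · simp only [cyc, Set.mem_ofPred_eq, ne_eq, not_iff_not, Equiv.Perm.inv_eq_iff_eq]
    exact eq_comm
  · simp only [cyc, Equiv.Perm.inv_eq_iff_eq, and_congr_right_iff]
    intro _
    rw [or_comm, eq_comm, @eq_comm _ a]

theorem Good.cyc_eq_iff {G : SimpleGraph V} {v : V} {c c' : Equiv.Perm V} (h : Good G v c)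
    (h' : Good G v c') : cyc G c' = cyc G c ↔ c' = c ∨ c' = c⁻¹ := by
  constructor
  · intro hc
    have h1 : c' v ∈ (cyc G c').neighborSet v := by
      rw [h'.neighborSet _ h'.2.1]
      simp
    rw [hc, h.neighborSet _ h.2.1] at h1
    rcases h1 with h1 | h1
    · exact Or.inl (h.eq_of_cyc_eq h' hc h1)
    · exact Or.inr (h.inv.eq_of_cyc_eq h' (hc.trans (cyc_inv G c).symm) h1)
  · rintro (rfl | rfl)
    · rfl
    · exact cyc_inv G _

theorem exists_good (G : SimpleGraph V) (v : V) (C : G.Subgraph) (hC : IsCycleSub G C)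
    (hv : v ∈ C.verts) : ∃ c, Good G v c ∧ cyc G c = C := by
  have hcyc : C.spanningCoe.IsCycles := by
    rintro w ⟨x, hx⟩
    exact hC.2.2 w (C.edge_vert hx)
  have hne : (C.spanningCoe.neighborSet v).Nonempty := by
    apply Set.nonempty_of_ncard_ne_zero
    have := hC.2.2 v hv
    change (C.neighborSet v).ncard ≠ 0
    omega
  obtain ⟨p, hp, hpv⟩ := hcyc.exists_cycle_toSubgraph_verts_eq_connectedComponentSupp
    (c := C.spanningCoe.connectedComponentMk v) (v := v) rfl hne
  have hsupp : (C.spanningCoe.connectedComponentMk v).supp = C.verts := by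
    ext w
    rw [SimpleGraph.ConnectedComponent.mem_supp_iff, SimpleGraph.ConnectedComponent.eq]
    constructor
    · intro h
      by_contra hw
      obtain ⟨q⟩ := h
      cases q with
      | nil => exact hw hv
      | cons ha _ => exact hw (C.edge_vert ha)
    · intro hw
      have h := hC.1.coe.preconnected ⟨w, hw⟩ ⟨v, hv⟩
      exact h.map (⟨fun x => x.1, fun {a b} hab => hab⟩ : C.coe →g C.spanningCoe)
  set l := p.support.tail with hl
  have hnd : l.Nodup := hp.support_nodup
  have hlen : l.length = p.length := by simp [hl]
  have h3 : 3 ≤ p.length := hp.three_le_length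
  have hget : ∀ i (hi : i < l.length), l[i] = p.getVert (i + 1) := by
    intro i hi
    simp only [hl, List.getElem_tail]
    exact p.support_getElem_eq_getVert _
  have hlne : ∀ x, l ≠ [x] := by
    intro x hx
    rw [hx] at hlen
    simp at hlen
    omega
  have hmem : ∀ x, x ∈ l ↔ x ∈ C.verts := by
    intro x
    rw [← hsupp, ← hpv, SimpleGraph.Walk.mem_verts_toSubgraph]
    refine ⟨List.mem_of_mem_tail, fun h => ?_⟩
    rw [SimpleGraph.Walk.mem_support_iff] at h
    rcases h with h | h
    · subst h
      exact SimpleGraph.Walk.end_mem_tail_support hp.not_nil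
    · exact h
  have hs : l.formPerm.support = l.toFinset := List.support_formPerm_of_nodup l hnd hlne
  have hs' : ∀ x, l.formPerm x ≠ x ↔ x ∈ C.verts := by
    intro x
    rw [← hmem, ← List.mem_toFinset, ← hs, Equiv.Perm.mem_support]
  have hadj : ∀ x, l.formPerm x ≠ x → C.Adj x (l.formPerm x) := by
    intro x hx
    rw [hs', ← hmem, List.mem_iff_getElem] at hx
    obtain ⟨i, hi, rfl⟩ := hx
    rw [List.formPerm_apply_getElem _ hnd, hget, hget]
    rcases Nat.lt_or_ge (i + 1) l.length with hlt | hge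
    · rw [Nat.mod_eq_of_lt hlt]
      exact p.adj_getVert_succ (by omega)
    · have : i + 1 = l.length := by omega
      rw [this, Nat.mod_self, hlen, p.getVert_length]
      have := p.adj_getVert_succ (i := 0) (by omega)
      rwa [p.getVert_zero] at this
  have hgood : Good G v l.formPerm := by
    refine ⟨List.isCycle_formPerm hnd (by omega), (hs' v).2 hv, fun x hx => (hadj x hx).adj_sub, ?_⟩
    rw [hs, List.toFinset_card_of_nodup hnd]
    omega
  refine ⟨l.formPerm, hgood, ?_⟩
  have hle : ∀ a b, (cyc G l.formPerm).Adj a b → C.Adj a b := by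
    rintro a b ⟨hab, h | h⟩
    · have := hadj a (by rw [h]; exact hab.ne')
      rwa [h] at this
    · have := hadj b (by rw [h]; exact hab.ne)
      rw [h] at this
      exact this.symm
  ext a b
  · exact hs' a
  · refine ⟨hle a b, fun h => ?_⟩
    have ha : a ∈ C.verts := C.edge_vert h
    have hsub : (cyc G l.formPerm).neighborSet a ⊆ C.neighborSet a := fun y hy => hle a y hy
    have := Set.eq_of_subset_of_ncard_le hsub (by
      rw [hC.2.2 a ha, hgood.isCycleSub.1.2.2 a ((hs' a).2 ha)]) (Set.toFinite _)
    have hb : b ∈ C.neighborSet a := h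
    rw [← this] at hb
    exact hb

theorem psi_delSub (A : Matrix V V (Polynomial ℝ)) (S : Set V)
    {i1 : Fintype {w : V // w ∉ S}} {i2 : DecidableEq {w : V // w ∉ S}} :
    @psi _ _ i1 i2 _ (delSub A S) =
      dper ((Polynomial.X : Polynomial ℝ) • (1 : Matrix V V (Polynomial ℝ)) - A) S := by
  unfold psi dper
  convert rfl using 2
  ext i j
  simp [delSub, Matrix.one_apply, Subtype.ext_iff]

/-- The sum over good permutations is twice the sum over cycles. -/
theorem sum_good (G : SimpleGraph V) (v : V) (h : G.Subgraph → Polynomial ℝ) :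
    ∑ c : Equiv.Perm V with Good G v c, h (cyc G c) =
      2 * ∑ᶠ C ∈ {C : G.Subgraph | IsCycleSub G C ∧ v ∈ C.verts}, h C := by
  have hfin : {C : G.Subgraph | IsCycleSub G C ∧ v ∈ C.verts}.Finite := Set.toFinite _
  rw [finsum_mem_eq_finite_toFinset_sum _ hfin, Finset.mul_sum]
  rw [← Finset.sum_fiberwise_of_maps_to (t := hfin.toFinset) (g := cyc G)]
  · refine Finset.sum_congr rfl ?_
    intro C hC
    rw [Set.Finite.mem_toFinset] at hC
    obtain ⟨c, hc, hcC⟩ := exists_good G v C hC.1 hC.2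
    have hne : c ≠ c⁻¹ := by
      intro h2
      apply hc.sq_ne v hc.2.1
      conv_lhs => rw [h2]
      rw [← h2]
      conv_lhs => enter [1]; rw [h2]
      simp
    have : ({c ∈ {c : Equiv.Perm V | Good G v c} | cyc G c = C} : Finset (Equiv.Perm V))
        = {c, c⁻¹} := by
      ext d
      simp only [Finset.mem_filter, Finset.mem_univ, true_and, Finset.mem_insert,
        Finset.mem_singleton]
      constructor
      · rintro ⟨hd, hdC⟩
        exact (hc.cyc_eq_iff hd).1 (hdC.trans hcC.symm)
      · rintro (rfl | rfl)
        · exact ⟨hc, hcC⟩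
        · exact ⟨hc.inv, (cyc_inv G c).trans hcC⟩
    rw [this, Finset.sum_pair hne, cyc_inv, hcC, two_mul]
  · intro c hc
    rw [Set.Finite.mem_toFinset]
    exact (Finset.mem_filter.1 hc).2.isCycleSub

theorem per_fiber_isCycle {R : Type*} [CommRing R] (M : Matrix V V R) (v : V) (c : Equiv.Perm V)
    (hc : c.IsCycle) (hv : c v ≠ v) :
    ∑ σ : Equiv.Perm V with σ.cycleOf v = c, ∏ i, M i (σ i) =
      (∏ i ∈ c.support, M i (c i)) * dper M {x | c x ≠ x} := by
  apply per_fiber M v _ _ c (fun i => by simp) hv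
  · intro i hi
    simpa using hi
  · exact hc.cycleOf_eq hv
  · intro σ hσ i hi
    have hi' : c i ≠ i := hi
    rw [← hσ, cycleOf_apply] at hi' ⊢
    split_ifs at hi' ⊢ with h
    · rfl
    · exact absurd rfl hi'

theorem per_fiber_one {R : Type*} [CommRing R] (M : Matrix V V R) (v : V) :
    ∑ σ : Equiv.Perm V with σ.cycleOf v = 1, ∏ i, M i (σ i) =
      M v v * dper M {v} := by
  rw [per_fiber M v {v} {v} 1 (by simp) rfl (fun _ _ => rfl) (cycleOf_one v)]
  · simp
  · rintro σ hσ i rfl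
    simpa [cycleOf_eq_one_iff] using hσ

theorem per_fiber_zero {R : Type*} [CommRing R] (M : Matrix V V R) (v : V) (c : Equiv.Perm V)
    (h1 : c ≠ 1) (hc : ¬ (c.IsCycle ∧ c v ≠ v)) :
    ∑ σ : Equiv.Perm V with σ.cycleOf v = c, ∏ i, M i (σ i) = 0 := by
  apply Finset.sum_eq_zero
  intro σ hσ
  rw [Finset.mem_filter] at hσ
  exfalso
  obtain ⟨_, rfl⟩ := hσ
  have h2 : σ v ≠ v := fun h => h1 ((cycleOf_eq_one_iff σ).2 h)
  exact hc ⟨isCycle_cycleOf σ h2, by rwa [cycleOf_apply_self]⟩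

theorem per_split {R : Type*} [CommRing R] (G : SimpleGraph V) [DecidableRel G.Adj]
    (M : Matrix V V R) (b : R) (v : V)
    (hM : ∀ i j, G.Adj i j → M i j = b) (hM' : ∀ i j, i ≠ j → ¬ G.Adj i j → M i j = 0) :
    M.per = M v v * dper M {v}
      + b ^ 2 * ∑ u ∈ G.neighborFinset v, dper M {u, v}
      + ∑ c : Equiv.Perm V with Good G v c,
          b ^ (cyc G c).verts.ncard * dper M (cyc G c).verts := by
  set g : Equiv.Perm V → R := fun c => ∑ σ : Equiv.Perm V with σ.cycleOf v = c, ∏ i, M i (σ i)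
    with hg
  have htot : M.per = ∑ c, g c := by
    unfold Matrix.per
    rw [hg, Finset.sum_fiberwise]
  have hcycle : ∀ c : Equiv.Perm V, c.IsCycle → c v ≠ v → (∀ x, c x ≠ x → G.Adj x (c x)) →
      g c = b ^ c.support.card * dper M {x | c x ≠ x} := by
    intro c hc hv hadj
    rw [hg]
    simp only
    rw [per_fiber_isCycle M v c hc hv]
    congr 1
    rw [Finset.prod_congr rfl (g := fun _ => b), Finset.prod_const]
    · intro x hx
      exact hM _ _ (hadj x (by simpa using hx))
  have hswap : ∀ u, G.Adj v u → (swap u v).IsCycle ∧ (swap u v) v ≠ v ∧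
      (∀ x, (swap u v) x ≠ x → G.Adj x ((swap u v) x)) ∧ (swap u v).support.card = 2 ∧
      {x | (swap u v) x ≠ x} = ({u, v} : Set V) := by
    intro u hu
    have hmem : ∀ x, (swap u v) x ≠ x ↔ x = u ∨ x = v := by
      intro x
      rw [Equiv.swap_apply_ne_self_iff]
      exact and_iff_right hu.ne'
    refine ⟨isCycle_swap hu.ne', by simpa using hu.ne', ?_, card_support_swap hu.ne', ?_⟩
    · intro x hx
      rcases (hmem x).1 hx with rfl | rfl
      · simpa using hu.symm
      · simpa using hu
    · ext x
      exact hmem x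
  have hdec : ∀ c, g c = (if c = 1 then g c else 0)
      + (if c ∈ (G.neighborFinset v).image (fun u => swap u v) then g c else 0)
      + (if Good G v c then g c else 0) := by
    intro c
    by_cases h1 : c = 1
    · have hT : c ∉ (G.neighborFinset v).image (fun u => swap u v) := by
        subst h1
        simp only [Finset.mem_image, SimpleGraph.mem_neighborFinset, not_exists, not_and]
        intro u hu h
        have := (hswap u hu).2.1
        rw [h] at this
        exact this rfl
      have hG : ¬ Good G v c := by
        subst h1
        exact fun h => h.2.1 rfl
      rw [if_pos h1, if_neg hT, if_neg hG]
      simp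
    by_cases hT : c ∈ (G.neighborFinset v).image (fun u => swap u v)
    · have hG : ¬ Good G v c := by
        intro h
        simp only [Finset.mem_image, SimpleGraph.mem_neighborFinset] at hT
        obtain ⟨u, hu, rfl⟩ := hT
        have h3 := h.2.2.2
        rw [(hswap u hu).2.2.2.1] at h3
        omega
      rw [if_neg h1, if_pos hT, if_neg hG]
      simp
    by_cases hG : Good G v c
    · rw [if_neg h1, if_neg hT, if_pos hG]
      simp
    rw [if_neg h1, if_neg hT, if_neg hG]
    simp only [add_zero]
    by_cases hc : c.IsCycle ∧ c v ≠ v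
    · obtain ⟨hc, hv⟩ := hc
      by_cases hadj : ∀ x, c x ≠ x → G.Adj x (c x)
      · exfalso
        have h2 := hc.two_le_card_support
        have h3 : c.support.card = 2 := by
          by_contra h4
          exact hG ⟨hc, hv, hadj, by omega⟩
        rw [Equiv.Perm.card_support_eq_two] at h3
        obtain ⟨x, y, hxy, rfl⟩ := h3
        apply hT
        rw [Finset.mem_image]
        rw [Equiv.swap_apply_ne_self_iff] at hv
        rcases hv.2 with rfl | rfl
        · refine ⟨y, ?_, Equiv.swap_comm _ _⟩
          rw [SimpleGraph.mem_neighborFinset]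
          simpa using hadj v (by simpa using hxy.symm)
        · refine ⟨x, ?_, rfl⟩
          rw [SimpleGraph.mem_neighborFinset]
          simpa using hadj v (by simpa using hxy)
      · push Not at hadj
        obtain ⟨x, hx, hxa⟩ := hadj
        rw [hg]
        simp only
        rw [per_fiber_isCycle M v c hc hv]
        have h0 : M x (c x) = 0 := hM' _ _ hx.symm hxa
        rw [Finset.prod_eq_zero (i := x) (by simpa using hx) h0, zero_mul]
    · exact per_fiber_zero M v c h1 hc
  rw [htot, Finset.sum_congr rfl (fun c _ => hdec c), Finset.sum_add_distrib,
    Finset.sum_add_distrib]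
  congr 1
  · congr 1
    · rw [Finset.sum_ite_eq' Finset.univ 1 g]
      simp only [Finset.mem_univ, if_true]
      exact per_fiber_one M v
    · rw [← Finset.sum_filter, Finset.filter_univ_mem, Finset.sum_image, Finset.mul_sum]
      · refine Finset.sum_congr rfl ?_
        intro u hu
        rw [SimpleGraph.mem_neighborFinset] at hu
        obtain ⟨a1, a2, a3, a4, a5⟩ := hswap u hu
        rw [hcycle _ a1 a2 a3, a4, a5]
      · intro u _ w _ h
        have := congrArg (fun e : Equiv.Perm V => e v) h
        simpa using this
  · rw [← Finset.sum_filter]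
    refine Finset.sum_congr rfl ?_
    intro c hc
    have hG := (Finset.mem_filter.1 hc).2
    rw [hcycle c hG.1 hG.2.1 hG.2.2.1]
    have : (cyc G c).verts = {x | c x ≠ x} := rfl
    rw [this]
    congr 2
    rw [← Set.ncard_coe_finset]
    congr 1
    ext x
    simp

end PermAux

theorem aAlpha_permanental_vertex_recursion
    {V : Type*} [Fintype V] [DecidableEq V]
    (G : SimpleGraph V) [DecidableRel G.Adj] (α : ℝ) (h0 : 0 ≤ α) (h1 : α ≤ 1) (v : V) :
    psi (aAlpha α G) =
      (Polynomial.X - Polynomial.C α * (G.degree v : Polynomial ℝ)) *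
          psi (delSub (aAlpha α G) {v})
        + Polynomial.C ((1 - α) ^ 2) *
            ∑ u ∈ G.neighborFinset v, psi (delSub (aAlpha α G) {u, v})
        + 2 * ∑ᶠ C ∈ {C : G.Subgraph | IsCycleSub G C ∧ v ∈ C.verts},
          Polynomial.C ((1 - α) ^ C.verts.ncard) * (-1 : Polynomial ℝ) ^ C.verts.ncard *
            psi (delSub (aAlpha α G) C.verts) := by

  have hoff : ∀ i j, i ≠ j →
      ((Polynomial.X : Polynomial ℝ) • (1 : Matrix V V (Polynomial ℝ)) - aAlpha α G) i j =
        - (Polynomial.C (1 - α) * if G.Adj i j then 1 else 0) := by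
    intro i j hij
    simp [aAlpha, degMat, hij,
      SimpleGraph.adjMatrix_apply]
  have hdiag : ((Polynomial.X : Polynomial ℝ) • (1 : Matrix V V (Polynomial ℝ)) - aAlpha α G) v v =
      Polynomial.X - Polynomial.C α * (G.degree v : Polynomial ℝ) := by
    simp [aAlpha, degMat]
  simp only [psi_delSub]
  generalize hMdef : (Polynomial.X : Polynomial ℝ) • (1 : Matrix V V (Polynomial ℝ)) - aAlpha α G = M
    at hoff hdiag ⊢
  have hsum := sum_good G v (fun C => Polynomial.C ((1 - α) ^ C.verts.ncard) *
    (-1 : Polynomial ℝ) ^ C.verts.ncard * dper M C.verts)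
  have hsplit := per_split G M (- Polynomial.C (1 - α)) v
    (fun i j h => by rw [hoff i j h.ne, if_pos h, mul_one])
    (fun i j hij h => by rw [hoff i j hij, if_neg h, mul_zero, neg_zero])
  have e1 : (- Polynomial.C (1 - α)) ^ 2 = Polynomial.C ((1 - α) ^ 2) := by
    rw [neg_sq, Polynomial.C_pow]
  have e2 : ∀ n : ℕ, (- Polynomial.C (1 - α)) ^ n =
      Polynomial.C ((1 - α) ^ n) * (-1 : Polynomial ℝ) ^ n := by
    intro n
    rw [neg_pow, Polynomial.C_pow, mul_comm]
  simp only [e1] at hsplit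
  simp only [e2] at hsplit
  rw [psi, hMdef, hsplit, hdiag, hsum]
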